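/- Let d ≥ 1 and let G : 𝕊(d) → ℝ be a function on the real d×d symmetric matrices that is monotone (G(A) ≥ G(B) whenever A − B is positive semidefinite), sublinear (G(A + B) ≤ G(A) + G(B) for all symmetric A, B, and G(λA) = λG(A) for all symmetric A and all λ ≥ 0), and non-degenerate in the sense that there exist constants 0 < σ̲² ≤ σ̄² such that (1/2)·σ̲²·tr(A − B) ≤ G(A) − G(B) ≤ (1/2)·σ̄²·tr(A − B) whenever A − B is positive semidefinite. Then there exists a bounded and closed subset Γ of the positive definite symmetric d×d matrices such that G(A) = (1/2)·sup_{Q ∈ Γ} tr(A·Q) for every symmetric d×d matrix A. -/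

import Mathlib

attribute [local instance] Matrix.normedAddCommGroup

open Matrix in
/-- A sublinear function on symmetric matrices is, at every symmetric `A`, attained by a linear
functional `M ↦ (1/2) tr (M Q)` that it dominates. -/
theorem Matrix.exists_isSymm_trace_mul_eq_of_sublinear {n : Type*} [Fintype n] [DecidableEq n]
    {G : Matrix n n ℝ → ℝ}
    (hsubadd : ∀ A B : Matrix n n ℝ, A.IsSymm → B.IsSymm → G (A + B) ≤ G A + G B)
    (hhom : ∀ A : Matrix n n ℝ, A.IsSymm → ∀ l : ℝ, 0 ≤ l → G (l • A) = l * G A)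
    {A : Matrix n n ℝ} (hA : A.IsSymm) :
    ∃ Q : Matrix n n ℝ, Q.IsSymm ∧
      (∀ B : Matrix n n ℝ, B.IsSymm → (1 / 2) * (B * Q).trace ≤ G B) ∧
      (1 / 2) * (A * Q).trace = G A := by
  have hG0 : G 0 = 0 := by simpa using hhom 0 Matrix.isSymm_zero 0 le_rfl
  have hpart (M : Matrix n n ℝ) : ((1 / 2 : ℝ) • (M + Mᵀ)).IsSymm :=
    (Matrix.isSymm_add_transpose_self M).smul _
  have hpart_eq {M : Matrix n n ℝ} (hM : M.IsSymm) : (1 / 2 : ℝ) • (M + Mᵀ) = M := by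
    rw [hM.eq, ← two_smul ℝ M, smul_smul]
    norm_num
  have hline (c : ℝ) : c * G A ≤ G (c • A) := by
    rcases le_total 0 c with hc | hc
    · exact (hhom A hA c hc).ge
    · have h1 := hhom A hA (-c) (neg_nonneg.2 hc)
      have h2 := hsubadd (c • A) (-c • A) (hA.smul c) (hA.smul (-c))
      rw [← add_smul, add_neg_cancel, zero_smul, hG0] at h2
      linarith
  have hzero (c : ℝ) (hc : c • A = 0) : c • G A = 0 := by
    rcases smul_eq_zero.1 hc with rfl | rfl
    · simp
    · simp [hG0]
  obtain ⟨g, hgA, hgle⟩ := exists_extension_of_le_sublinear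
    (LinearPMap.mkSpanSingleton' A (G A) hzero) (fun M => G ((1 / 2 : ℝ) • (M + Mᵀ)))
    (fun c hc M => by
      rw [← hhom _ (hpart M) c hc.le, Matrix.transpose_smul, ← smul_add, smul_comm])
    (fun M N => by
      refine le_of_eq_of_le (congrArg G ?_) (hsubadd _ _ (hpart M) (hpart N))
      rw [Matrix.transpose_add, ← smul_add, add_add_add_comm])
    (fun x => by
      obtain ⟨x, hx⟩ := x
      obtain ⟨c, rfl⟩ := Submodule.mem_span_singleton.1 hx
      rw [LinearPMap.mkSpanSingleton'_apply, smul_eq_mul]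
      simpa only [hpart_eq (hA.smul c), RingHom.id_apply] using hline c)
  have hg_transpose_le (M : Matrix n n ℝ) : g M ≤ g Mᵀ := by
    have h := hgle (M - Mᵀ)
    rw [show (M - Mᵀ) + (M - Mᵀ)ᵀ = 0 by simp, smul_zero, hG0, map_sub] at h
    linarith
  have hg_transpose (M : Matrix n n ℝ) : g Mᵀ = g M :=
    le_antisymm (by simpa using hg_transpose_le Mᵀ) (hg_transpose_le M)
  let Q : Matrix n n ℝ := Matrix.of fun i j => 2 * g (Matrix.single j i 1)
  have htrace (B : Matrix n n ℝ) : (1 / 2) * (B * Q).trace = g B := by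
    conv_rhs => rw [Matrix.matrix_eq_sum_single B]
    simp only [Matrix.trace, Matrix.diag, Matrix.mul_apply, map_sum, Finset.mul_sum, Q,
      Matrix.of_apply]
    refine Finset.sum_congr rfl fun i _ => Finset.sum_congr rfl fun j _ => ?_
    rw [show Matrix.single i j (B i j) = B i j • Matrix.single i j (1 : ℝ) by simp, map_smul,
      smul_eq_mul]
    ring
  refine ⟨Q, ?_, fun B hB => ?_, ?_⟩
  · ext i j
    simp only [Q, Matrix.transpose_apply, Matrix.of_apply]
    rw [← hg_transpose, Matrix.transpose_single]
  · rw [htrace]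
    simpa only [hpart_eq hB] using hgle B
  · rw [htrace]
    have h := hgA ⟨A, Submodule.mem_span_singleton_self A⟩
    exact h.trans (LinearPMap.mkSpanSingleton'_apply_self A (G A) hzero _)

/-- Representation of a monotone, sublinear, non-degenerate function `G` on real
`d × d` symmetric matrices as `G(A) = (1/2) ⨆_{Q ∈ Γ} tr (A Q)` for a bounded and
closed set `Γ` of positive definite symmetric matrices. -/
theorem stmt0 (d : ℕ) (hd : 1 ≤ d) (G : Matrix (Fin d) (Fin d) ℝ → ℝ)
    (hmono : ∀ A B : Matrix (Fin d) (Fin d) ℝ, A.IsSymm → B.IsSymm →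
      (A - B).PosSemidef → G B ≤ G A)
    (hsubadd : ∀ A B : Matrix (Fin d) (Fin d) ℝ, A.IsSymm → B.IsSymm →
      G (A + B) ≤ G A + G B)
    (hhom : ∀ A : Matrix (Fin d) (Fin d) ℝ, A.IsSymm → ∀ l : ℝ, 0 ≤ l →
      G (l • A) = l * G A)
    (σlo σhi : ℝ) (hσlo : 0 < σlo) (hσ : σlo ≤ σhi)
    (hnd : ∀ A B : Matrix (Fin d) (Fin d) ℝ, A.IsSymm → B.IsSymm → (A - B).PosSemidef →
      (1 / 2) * σlo * (A - B).trace ≤ G A - G B ∧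
        G A - G B ≤ (1 / 2) * σhi * (A - B).trace) :
    ∃ Γ : Set (Matrix (Fin d) (Fin d) ℝ),
      (∀ Q ∈ Γ, Q.PosDef) ∧ Bornology.IsBounded Γ ∧ IsClosed Γ ∧
      ∀ A : Matrix (Fin d) (Fin d) ℝ, A.IsSymm →
        G A = (1 / 2) * sSup ((fun Q => (A * Q).trace) '' Γ) := by
  have hG0 : G 0 = 0 := by simpa using hhom 0 Matrix.isSymm_zero 0 le_rfl
  refine ⟨{Q | Q.IsSymm ∧ ∀ B : Matrix (Fin d) (Fin d) ℝ, B.IsSymm →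
    (1 / 2) * (B * Q).trace ≤ G B}, ?_, ?_, ?_, ?_⟩
  · rintro Q ⟨hQ, hQG⟩
    refine Matrix.PosDef.of_dotProduct_mulVec_pos
      (by rwa [Matrix.IsHermitian, Matrix.conjTranspose_eq_transpose_of_trivial]) fun v hv => ?_
    have hsymm : (-Matrix.vecMulVec v v).IsSymm := by
      simp [Matrix.IsSymm, Matrix.transpose_vecMulVec]
    have hpsd : (0 - -Matrix.vecMulVec v v).PosSemidef := by
      simpa using Matrix.posSemidef_vecMulVec_self_star v
    have hlower := (hnd 0 _ Matrix.isSymm_zero hsymm hpsd).1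
    have hupper := hQG _ hsymm
    rw [Matrix.neg_mul, Matrix.trace_neg, Matrix.vecMulVec_mul, Matrix.trace_vecMulVec,
      dotProduct_comm, ← Matrix.dotProduct_mulVec] at hupper
    rw [hG0, zero_sub (-_), neg_neg, Matrix.trace_vecMulVec] at hlower
    have hvv : 0 < v ⬝ᵥ v := by simpa using Matrix.dotProduct_star_self_pos_iff.2 hv
    have := mul_pos hσlo hvv
    simp only [star_trivial]
    linarith
  · let E (i j : Fin d) : Matrix (Fin d) (Fin d) ℝ :=
      Matrix.single i j 1 + Matrix.single j i 1
    have hE (i j : Fin d) : (E i j).IsSymm := by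
      simp [E, Matrix.IsSymm, Matrix.transpose_add, Matrix.transpose_single, add_comm]
    have hbound (i j : Fin d) : |G (E i j)| + |G (-E i j)| ≤
        ∑ i, ∑ j, (|G (E i j)| + |G (-E i j)|) :=
      (Finset.single_le_sum (f := fun j => |G (E i j)| + |G (-E i j)|)
        (fun _ _ => by positivity) (Finset.mem_univ j)).trans
      (Finset.single_le_sum (f := fun i => ∑ j, (|G (E i j)| + |G (-E i j)|))
        (fun _ _ => by positivity) (Finset.mem_univ i))
    refine isBounded_iff_forall_norm_le.2 ⟨∑ i, ∑ j, (|G (E i j)| + |G (-E i j)|), ?_⟩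
    rintro Q ⟨hQ, hQG⟩
    refine (Matrix.norm_le_iff (by positivity)).2 fun i j => le_trans ?_ (hbound i j)
    have htrace : (E i j * Q).trace = 2 * Q i j := by
      simp only [E, Matrix.add_mul, Matrix.trace_add, Matrix.trace_single_mul]
      rw [hQ.apply i j]
      simp [two_mul]
    have h1 := hQG _ (hE i j)
    have h2 := hQG _ (hE i j).neg
    rw [Matrix.neg_mul, Matrix.trace_neg, htrace] at h2
    rw [htrace] at h1
    have := le_abs_self (G (E i j))
    have := le_abs_self (G (-E i j))
    have := abs_nonneg (G (E i j))
    have := abs_nonneg (G (-E i j))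
    rw [Real.norm_eq_abs, abs_le]
    constructor <;> linarith
  · simp only [Set.ofPred_and, Set.ofPred_forall]
    refine (isClosed_eq (by fun_prop) continuous_id).inter
      (isClosed_iInter fun B => isClosed_iInter fun _ => isClosed_le ?_ continuous_const)
    exact continuous_const.mul (continuous_const.matrix_mul continuous_id).matrix_trace
  · intro A hA
    obtain ⟨Q, hQ, hQG, hQA⟩ :=
      Matrix.exists_isSymm_trace_mul_eq_of_sublinear hsubadd hhom hA
    have hgreatest : IsGreatest ((fun Q => (A * Q).trace) '' {Q | Q.IsSymm ∧
        ∀ B : Matrix (Fin d) (Fin d) ℝ, B.IsSymm → (1 / 2) * (B * Q).trace ≤ G B})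
        (A * Q).trace := by
      refine ⟨⟨Q, ⟨hQ, hQG⟩, rfl⟩, ?_⟩
      rintro _ ⟨R, ⟨-, hRG⟩, rfl⟩
      have := hRG A hA
      simp only
      linarith
    rw [hgreatest.csSup_eq, hQA]
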